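/- arXiv:1612.02671 — 4 statements merged into one kernel-verified Lean document; each statement's English description precedes it below -/
import Mathlib

section
/- Every d-decorated noncrossing partition of [n] is ε-noncrossing; that is, NC^{d}_n ⊆ P^{d,ε}_n for every decoration d of [n]. -/
/-!
Common setup: ε-noncrossing partitions (Ebrahimi-Fard–Patras–Speicher).

A partition of `[n]` is encoded as a `Setoid (Fin n)` (blocks = equivalence
classes).  A decoration is a map `d : Fin n → I`, and `ε : I → I → Bool` is a
symmetric family of values in `{0,1}` (with `true` playing the role of `1`).
-/

namespace EpsNC

open scoped Classical

variable {I : Type*}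

/-- The partition `σ(Γ)`: blocks are the images under `σ` of the blocks of `Γ`. -/
def permSetoid {n : ℕ} (σ : Equiv.Perm (Fin n)) (Γ : Setoid (Fin n)) : Setoid (Fin n) :=
  Setoid.comap (⇑σ⁻¹) Γ

/-- The decoration `σ(d)`, `σ(d)(i) = d(σ⁻¹(i))`. -/
def permDec {n : ℕ} (σ : Equiv.Perm (Fin n)) (d : Fin n → I) : Fin n → I :=
  d ∘ ⇑σ⁻¹

/-- The adjacent transposition `(i, j)` with `j = i + 1` is an allowed move for the
`d`-decorated partition `Γ` if `ε_{d(i)d(j)} = 1` and either `d(i) ≠ d(j)`, or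
`d(i) = d(j)` and `i`, `j` lie in different blocks of `Γ`. -/
def IsAllowedMove {n : ℕ} (ε : I → I → Bool) (d : Fin n → I) (Γ : Setoid (Fin n))
    (i j : Fin n) : Prop :=
  (i : ℕ) + 1 = (j : ℕ) ∧ ε (d i) (d j) = true ∧ (d i ≠ d j ∨ ¬ Γ i j)

/-- `σ` is an allowed permutation of the `d`-decorated partition `Γ` if it is a product
`τ_{i_k} ⋯ τ_{i_1}` of adjacent transpositions, each being an allowed move for the
(decorated) partition obtained by applying the previous ones. -/
inductive AllowedPerm {n : ℕ} (ε : I → I → Bool) (d : Fin n → I) (Γ : Setoid (Fin n)) :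
    Equiv.Perm (Fin n) → Prop
  | one : AllowedPerm ε d Γ 1
  | step {σ : Equiv.Perm (Fin n)} (i j : Fin n) :
      AllowedPerm ε d Γ σ →
      IsAllowedMove ε (permDec σ d) (permSetoid σ Γ) i j →
      AllowedPerm ε d Γ (Equiv.swap i j * σ)

/-- Standardization of the restriction of a map on `Fin n` to a subset `S`,
via the unique order isomorphism `Fin S.card ≃o S`. -/
noncomputable def restrictFun {n : ℕ} {α : Type*} (f : Fin n → α) (S : Finset (Fin n)) :
    Fin S.card → α :=
  fun k => f (S.orderIsoOfFin rfl k).1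

/-- Standardization of the restriction of a partition of `Fin n` to a subset `S`,
via the unique order isomorphism `Fin S.card ≃o S` (blocks are the nonempty
intersections of blocks with `S`, transported to `Fin S.card`). -/
noncomputable def restrictSetoid {n : ℕ} (Γ : Setoid (Fin n)) (S : Finset (Fin n)) :
    Setoid (Fin S.card) :=
  Setoid.comap (fun k => (S.orderIsoOfFin rfl k).1) Γ

/-- The block of the partition `Γ` containing `b`. -/
noncomputable def blockOf {n : ℕ} (Γ : Setoid (Fin n)) (b : Fin n) : Finset (Fin n) :=
  Finset.univ.filter (fun x => Γ b x)

/-- A subset of `Fin n` is an interval of consecutive integers iff it is order-connected. -/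
def IsIntervalBlock {n : ℕ} (S : Finset (Fin n)) : Prop :=
  ∀ ⦃x y z : Fin n⦄, x ∈ S → z ∈ S → x ≤ y → y ≤ z → y ∈ S

/-- A `d`-decorated partition `Γ` of `[n]` is ε-noncrossing if it can be reduced to the
empty partition by a finite sequence of reductions: a reduction consists of an allowed
permutation `σ` of `Γ` together with a block of `σ(Γ)` which is an interval of
consecutive integers; it deletes that block and standardizes the result. -/
inductive IsEpsNC (ε : I → I → Bool) : {n : ℕ} → (Fin n → I) → Setoid (Fin n) → Prop
  | empty (d : Fin 0 → I) (Γ : Setoid (Fin 0)) : IsEpsNC ε d Γ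
  | reduce {n : ℕ} {d : Fin n → I} {Γ : Setoid (Fin n)}
      (σ : Equiv.Perm (Fin n)) (b : Fin n)
      (hσ : AllowedPerm ε d Γ σ)
      (hint : IsIntervalBlock (blockOf (permSetoid σ Γ) b))
      (hrec : IsEpsNC ε
        (restrictFun (permDec σ d) (blockOf (permSetoid σ Γ) b)ᶜ)
        (restrictSetoid (permSetoid σ Γ) (blockOf (permSetoid σ Γ) b)ᶜ)) :
      IsEpsNC ε d Γ

/-- A partition of `[n]` is noncrossing if there are no `i < j < k < l` with `i, k` in
one block and `j, l` in a different block. -/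
def IsNoncrossing {n : ℕ} (Γ : Setoid (Fin n)) : Prop :=
  ∀ ⦃i j k l : Fin n⦄, i < j → j < k → k < l → Γ i k → Γ j l → Γ i j

/-- The set of blocks of a partition, as finsets. -/
noncomputable def blocksSet {n : ℕ} (Γ : Setoid (Fin n)) : Set (Finset (Fin n)) :=
  {B | ∃ b : Fin n, B = blockOf Γ b}

/-- `k_ε^Γ(a₁, …, aₙ)`: the product over the blocks `Γ_j = {x₁ < … < x_m}` of `Γ` of the
cumulants `κ(a_{x₁}, …, a_{x_m})` (with the corresponding decorations). -/
noncomputable def cumPart {K A : Type*} [Field K] {n : ℕ}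
    (κ : (m : ℕ) → (Fin m → I) → (Fin m → A) → K)
    (d : Fin n → I) (Γ : Setoid (Fin n)) (a : Fin n → A) : K :=
  ∏ᶠ B ∈ blocksSet Γ, κ B.card (restrictFun d B) (restrictFun a B)

/-- `φ^Γ(a₁, …, aₙ)`: the product over the blocks `Γ_j = {x₁ < … < x_m}` of `Γ` of the
moments `φ(a_{x₁} ⋯ a_{x_m})`. -/
noncomputable def phiPart {K A : Type*} [Field K] [Ring A] [Algebra K A] {n : ℕ}
    (φ : A →ₗ[K] K) (Γ : Setoid (Fin n)) (a : Fin n → A) : K :=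
  ∏ᶠ B ∈ blocksSet Γ, φ (List.ofFn (restrictFun a B)).prod

/-- The set of setoids on a finite type is finite (needed so that the sums over sets of
ε-noncrossing partitions below, taken with `∑ᶠ`, are honest finite sums). -/
instance {n : ℕ} : Finite (Setoid (Fin n)) :=
  Finite.of_injective (fun Γ : Setoid (Fin n) => ⇑Γ)
    (fun _ _ h => Setoid.ext fun x y => iff_of_eq (congrFun (congrFun h x) y))

/-- `κ` is the family of ε-cumulants of the noncommutative probability space `(A, φ)`
with distinguished subalgebras `(As i)_{i ∈ I}`: for every `n`, every decoration
`d : Fin n → I` and every tuple `a` with `a j ∈ As (d j)`, the moment-cumulant relation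
`φ(a₁ ⋯ aₙ) = Σ_{Γ ∈ P^{d,ε}_n} k_ε^Γ(a)` holds.  (This relation determines `κ`
uniquely on such tuples.) -/
def CumulantFamily {K A : Type*} [Field K] [Ring A] [Algebra K A]
    (ε : I → I → Bool) (φ : A →ₗ[K] K) (As : I → Subalgebra K A)
    (κ : (m : ℕ) → (Fin m → I) → (Fin m → A) → K) : Prop :=
  ∀ (m : ℕ) (d : Fin m → I) (a : Fin m → A), (∀ j, a j ∈ As (d j)) →
    φ (List.ofFn a).prod = ∑ᶠ Γ ∈ {Γ : Setoid (Fin m) | IsEpsNC ε d Γ}, cumPart κ d Γ a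

/-- The tuple `d = (d 1, …, d n)` lies in `I_n^ε`: whenever `d k = d l` for `k < l`,
there is `k < p < l` with `d p ≠ d k` and `ε_{d(p)d(k)} = 0`. -/
def MemIeps {n : ℕ} (ε : I → I → Bool) (d : Fin n → I) : Prop :=
  ∀ k l : Fin n, k < l → d k = d l →
    ∃ p : Fin n, k < p ∧ p < l ∧ d p ≠ d k ∧ ε (d p) (d k) = false

/-- The subalgebras `(As i)_{i ∈ I}` are ε-independent in `(A, φ)`. -/
def EpsIndependent {K A : Type*} [Field K] [Ring A] [Algebra K A]
    (ε : I → I → Bool) (φ : A →ₗ[K] K) (As : I → Subalgebra K A) : Prop :=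
  (∀ i j : I, i ≠ j → ε i j = true →
    ∀ a ∈ As i, ∀ b ∈ As j, a * b = b * a) ∧
  (∀ (n : ℕ) (d : Fin n → I) (a : Fin n → A), MemIeps ε d →
    (∀ k, a k ∈ As (d k)) → (∀ k, φ (a k) = 0) → φ (List.ofFn a).prod = 0)

/-- The join of two partitions in the lattice `P^{d,ε}_n` of ε-noncrossing partitions:
the finest ε-noncrossing partition coarser than both (computed as the meet, in the full
partition lattice, of all ε-noncrossing upper bounds). -/
noncomputable def epsJoin {n : ℕ} (ε : I → I → Bool) (d : Fin n → I)
    (Φ Ψ : Setoid (Fin n)) : Setoid (Fin n) :=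
  sInf {Θ : Setoid (Fin n) | IsEpsNC ε d Θ ∧ Φ ≤ Θ ∧ Ψ ≤ Θ}

lemma permSetoid_one {n : ℕ} (Γ : Setoid (Fin n)) : permSetoid 1 Γ = Γ :=
  Setoid.ext fun _ _ => Iff.rfl

lemma IsNoncrossing.restrictSetoid {n : ℕ} {Γ : Setoid (Fin n)} (hΓ : IsNoncrossing Γ)
    (S : Finset (Fin n)) : IsNoncrossing (restrictSetoid Γ S) := by
  intro i j k l hij hjk hkl hik hjl
  have hmono {a b : Fin S.card} (h : a < b) :
      (S.orderIsoOfFin rfl a).1 < (S.orderIsoOfFin rfl b).1 :=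
    (S.orderIsoOfFin rfl).strictMono h
  exact hΓ (hmono hij) (hmono hjk) (hmono hkl) hik hjl

/-- In a noncrossing partition, the block whose minimum is largest is an interval. -/
lemma IsNoncrossing.exists_isIntervalBlock {n : ℕ} [NeZero n] {Γ : Setoid (Fin n)}
    (hΓ : IsNoncrossing Γ) : ∃ b, IsIntervalBlock (blockOf Γ b) := by
  have exists_min (y : Fin n) : ∃ m, Γ y m ∧ ∀ x, Γ y x → m ≤ x := by
    obtain ⟨m, hm, hmin⟩ := (blockOf Γ y).exists_min_image id
      ⟨y, by simp [blockOf]⟩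
    simp only [blockOf, Finset.mem_filter, Finset.mem_univ, true_and, id] at hm hmin
    exact ⟨m, hm, hmin⟩
  obtain ⟨b, hb, hmax⟩ := (Finset.univ.filter fun b : Fin n => ∀ x, Γ b x → b ≤ x).exists_max_image
    id ⟨0, by simp⟩
  simp only [Finset.mem_filter, Finset.mem_univ, true_and, id] at hb hmax
  refine ⟨b, fun x y z hx hz hxy hyz => ?_⟩
  simp only [blockOf, Finset.mem_filter, Finset.mem_univ, true_and] at hx hz ⊢
  by_contra hy
  obtain ⟨m, hym, hm⟩ := exists_min y
  have hmx : m ≤ x := (hmax m fun w hw => hm w (Γ.trans hym hw)).trans (hb x hx)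
  have hnx : ¬ Γ m x := fun h => hy (Γ.trans hx (Γ.symm (Γ.trans hym h)))
  have hlt : m < x := hmx.lt_of_ne fun h => hnx (h ▸ Γ.refl m)
  have hlt' : x < y := hxy.lt_of_ne fun h => hy (h ▸ hx)
  have hlt'' : y < z := hyz.lt_of_ne fun h => hy (h ▸ hz)
  exact hnx (hΓ hlt hlt' hlt'' (Γ.symm hym) (Γ.trans (Γ.symm hx) hz))

/-- Every `d`-decorated noncrossing partition of `[n]` is
ε-noncrossing: `NC^d_n ⊆ P^{d,ε}_n` for every decoration `d` of `[n]`. -/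
theorem noncrossing_isEpsNC {I : Type*} (ε : I → I → Bool)
    (hsym : ∀ i j : I, ε i j = ε j i)
    {n : ℕ} (d : Fin n → I) (Γ : Setoid (Fin n)) (hΓ : IsNoncrossing Γ) :
    IsEpsNC ε d Γ := by
  induction n using Nat.strong_induction_on with
  | _ n ih =>
    rcases Nat.eq_zero_or_pos n with rfl | hn
    · exact .empty d Γ
    · have : NeZero n := ⟨hn.ne'⟩
      obtain ⟨b, hb⟩ := hΓ.exists_isIntervalBlock
      refine .reduce 1 b .one (by rwa [permSetoid_one]) ?_
      rw [permSetoid_one]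
      refine ih _ ?_ _ _ (hΓ.restrictSetoid _)
      have hmem : b ∈ blockOf Γ b := by simp [blockOf]
      have hlt := Finset.card_lt_univ_of_notMem (s := (blockOf Γ b)ᶜ) (x := b) (by simpa using hmem)
      simpa using hlt

end EpsNC
end

section
/- Let d be a decoration of [n] such that ε_{d(i)d(j)} = 1 for all i ≠ j in [n]. Then every d-decorated partition of [n] is ε-noncrossing. -/
/-!
Common setup: ε-noncrossing partitions (Ebrahimi-Fard–Patras–Speicher).

A partition of `[n]` is encoded as a `Setoid (Fin n)` (blocks = equivalence
classes).  A decoration is a map `d : Fin n → I`, and `ε : I → I → Bool` is a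
symmetric family of values in `{0,1}` (with `true` playing the role of `1`).
-/

namespace EpsNC

open scoped Classical

variable {I : Type*}

theorem of_le_of_adjacent {n : ℕ} {q : Fin n → Prop}
    (h : ∀ i j : Fin n, (i : ℕ) + 1 = j → q j → q i) {i j : Fin n} (hij : i ≤ j) (hj : q j) :
    q i := by
  obtain ⟨k, hk⟩ : ∃ k : ℕ, (i : ℕ) + k = j := Nat.exists_eq_add_of_le hij |>.imp fun _ => Eq.symm
  clear hij
  induction k generalizing i with
  | zero =>
    obtain rfl : i = j := Fin.ext hk
    exact hj
  | succ k ih =>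
    exact h i ⟨i + 1, by omega⟩ rfl (ih (i := ⟨i + 1, by omega⟩) (by simp only; omega))

/-- Exchanging an adjacent pair whose right entry alone satisfies `p` lowers the sum of the
positions of the elements satisfying `p`. -/
theorem sum_position_swap_mul_lt {n : ℕ} {p : Fin n → Prop} {σ : Equiv.Perm (Fin n)} {i j : Fin n}
    (hij : i < j) (hi : ¬ p (σ⁻¹ i)) (hj : p (σ⁻¹ j)) :
    ∑ x with p x, ((Equiv.swap i j * σ) x : ℕ) < ∑ x with p x, (σ x : ℕ) := by
  refine Finset.sum_lt_sum (fun x hx => ?_) ⟨σ⁻¹ j, by simpa using hj, by simpa using hij⟩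
  have hxi : σ x ≠ i := by
    rintro rfl
    exact hi (by simpa using hx)
  rw [Equiv.Perm.mul_apply]
  by_cases hxj : σ x = j
  · rw [hxj, Equiv.swap_apply_right]
    exact hij.le
  · rw [Equiv.swap_apply_of_ne_of_ne hxi hxj]

/-- If all values of `ε` on distinct positions are `1`, a union of blocks can be moved to the
front by an allowed permutation. -/
theorem exists_allowedPerm_antitone {ε : I → I → Bool} {n : ℕ} {d : Fin n → I}
    (hd : ∀ i j : Fin n, i ≠ j → ε (d i) (d j) = true) (Γ : Setoid (Fin n))
    {p : Fin n → Prop} (hp : ∀ x y, Γ x y → p y → p x) :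
    ∃ σ, AllowedPerm ε d Γ σ ∧ ∀ i j, i ≤ j → p (σ⁻¹ j) → p (σ⁻¹ i) := by
  obtain ⟨σ, hσ, hmin⟩ := exists_minimalFor_of_wellFoundedLT (AllowedPerm ε d Γ)
    (fun σ => ∑ x with p x, (σ x : ℕ)) ⟨1, .one⟩
  refine ⟨σ, hσ, fun i j => of_le_of_adjacent (q := fun i => p (σ⁻¹ i)) fun i j hij hj => ?_⟩
  by_contra hi
  have hlt : i < j := Fin.lt_def.2 (by omega)
  have hstep : AllowedPerm ε d Γ (Equiv.swap i j * σ) :=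
    .step i j hσ ⟨hij, hd _ _ (σ⁻¹.injective.ne hlt.ne), .inr fun h => hi (hp _ _ h hj)⟩
  have hdecr := sum_position_swap_mul_lt (p := p) hlt hi hj
  exact hdecr.not_ge (hmin hstep hdecr.le)

/-- If `ε_{d(i)d(j)} = 1` for all `i ≠ j` in `[n]`, then every
`d`-decorated partition of `[n]` is ε-noncrossing. -/
theorem isEpsNC_of_forall_one {I : Type*} (ε : I → I → Bool)
    (hsym : ∀ i j : I, ε i j = ε j i)
    {n : ℕ} (d : Fin n → I) (hd : ∀ i j : Fin n, i ≠ j → ε (d i) (d j) = true)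
    (Γ : Setoid (Fin n)) :
    IsEpsNC ε d Γ := by
  induction n using Nat.strong_induction_on with
  | _ n ih =>
    rcases n.eq_zero_or_pos with rfl | hn
    · exact .empty d Γ
    let b : Fin n := ⟨0, hn⟩
    obtain ⟨σ, hσ, hanti⟩ := exists_allowedPerm_antitone hd Γ (p := fun x => Γ b x)
      fun _ _ hxy hy => Γ.trans hy (Γ.symm hxy)
    have hmem (x : Fin n) : x ∈ blockOf (permSetoid σ Γ) (σ b) ↔ Γ b (σ⁻¹ x) := by
      change x ∈ Finset.univ.filter (fun x => Γ (σ⁻¹ (σ b)) (σ⁻¹ x)) ↔ _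
      rw [Finset.mem_filter_univ, Equiv.Perm.inv_def, Equiv.symm_apply_apply]
    refine .reduce σ (σ b) hσ (fun x y z _ hz _ hyz => ?_) (ih _ ?_ _ (fun i j hij => ?_) _)
    · exact (hmem y).2 (hanti y z hyz ((hmem z).1 hz))
    · refine (Finset.card_lt_univ_of_notMem (x := σ b) ?_).trans_eq (Fintype.card_fin n)
      simp [hmem]
    · exact hd _ _ (σ⁻¹.injective.ne
        (Subtype.val_injective.ne ((Finset.orderIsoOfFin _ rfl).injective.ne hij)))

end EpsNC
end

section
/- Let Γ be a d-decorated ε-noncrossing partition of [n] and let i ∈ [n]. Let Γ' be the standardization of the restriction of Γ to [n] \ {i} (blocks Γ_j ∩ ([n] \ {i}), empty intersections discarded), with decoration d' the standardization of the restriction of d to [n] \ {i}. Then Γ' is a d'-decorated ε-noncrossing partition of [n−1]. -/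
/-!
Common setup: ε-noncrossing partitions (Ebrahimi-Fard–Patras–Speicher).

A partition of `[n]` is encoded as a `Setoid (Fin n)` (blocks = equivalence
classes).  A decoration is a map `d : Fin n → I`, and `ε : I → I → Bool` is a
symmetric family of values in `{0,1}` (with `true` playing the role of `1`).
-/

namespace EpsNC

open scoped Classical

variable {I : Type*}

theorem permDec_apply {n : ℕ} (σ : Equiv.Perm (Fin n)) (d : Fin n → I) (x : Fin n) :
    permDec σ d x = d (σ.symm x) := rfl

theorem permSetoid_rel {n : ℕ} (σ : Equiv.Perm (Fin n)) (Γ : Setoid (Fin n)) (x y : Fin n) :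
    permSetoid σ Γ x y ↔ Γ (σ.symm x) (σ.symm y) := Iff.rfl

theorem restrictSetoid_rel {n : ℕ} (Γ : Setoid (Fin n)) (S : Finset (Fin n))
    (x y : Fin S.card) : restrictSetoid Γ S x y ↔
      Γ (S.orderIsoOfFin rfl x).1 (S.orderIsoOfFin rfl y).1 := Iff.rfl

theorem permDec_mul {n : ℕ} (τ σ : Equiv.Perm (Fin n)) (d : Fin n → I) :
    permDec (τ * σ) d = permDec τ (permDec σ d) := rfl

theorem permSetoid_mul {n : ℕ} (τ σ : Equiv.Perm (Fin n)) (Γ : Setoid (Fin n)) :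
    permSetoid (τ * σ) Γ = permSetoid τ (permSetoid σ Γ) := rfl

theorem AllowedPerm.mul {n : ℕ} {ε : I → I → Bool} {d : Fin n → I} {Γ : Setoid (Fin n)}
    {σ τ : Equiv.Perm (Fin n)} (hσ : AllowedPerm ε d Γ σ)
    (hτ : AllowedPerm ε (permDec σ d) (permSetoid σ Γ) τ) : AllowedPerm ε d Γ (τ * σ) := by
  induction hτ with
  | one => simpa using hσ
  | step i j _ hmove ih =>
    rw [mul_assoc]
    refine .step i j ih ?_
    rwa [permDec_mul, permSetoid_mul]

/-- A decorated partition is ε-noncrossing as soon as its image under some allowed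
permutation is. -/
theorem IsEpsNC.of_perm {n : ℕ} {ε : I → I → Bool} {d : Fin n → I} {Γ : Setoid (Fin n)}
    {σ : Equiv.Perm (Fin n)} (hσ : AllowedPerm ε d Γ σ)
    (h : IsEpsNC ε (permDec σ d) (permSetoid σ Γ)) : IsEpsNC ε d Γ := by
  generalize hd : permDec σ d = d' at h
  generalize hΓ : permSetoid σ Γ = Γ' at h
  cases h with
  | empty => exact .empty d Γ
  | reduce τ b hτ hint hrec =>
    subst hd hΓ
    rw [← permSetoid_mul] at hint
    rw [← permSetoid_mul, ← permDec_mul] at hrec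
    exact .reduce (τ * σ) b (hσ.mul hτ) hint hrec

/-- An adjacent transposition of which a strictly monotone map misses a point preserves
the strict monotonicity of that map. -/
theorem strictMono_swap_comp {m n : ℕ} {f : Fin m → Fin n} (hf : StrictMono f) {i j : Fin n}
    (hij : (i : ℕ) + 1 = j) (h : ¬ ((∃ k, f k = i) ∧ ∃ l, f l = j)) :
    StrictMono (Equiv.swap i j ∘ f) := by
  intro x y hxy
  have hlt := hf hxy
  have hxy' : ¬ (f x = i ∧ f y = j) := fun ⟨hx, hy⟩ => h ⟨⟨x, hx⟩, ⟨y, hy⟩⟩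
  simp only [Function.comp_apply, Equiv.swap_apply_def]
  split_ifs <;> simp only [Fin.lt_def, Fin.ext_iff] at * <;> omega

/-- Pulling back an allowed permutation along a strictly monotone map. -/
theorem AllowedPerm.exists_comp_eq {m n : ℕ} {ε : I → I → Bool} {d : Fin n → I}
    {Γ : Setoid (Fin n)} {σ : Equiv.Perm (Fin n)} (hσ : AllowedPerm ε d Γ σ)
    {f : Fin m → Fin n} (hf : StrictMono f) :
    ∃ (σ' : Equiv.Perm (Fin m)) (f' : Fin m → Fin n), StrictMono f' ∧
      AllowedPerm ε (d ∘ f) (Γ.comap f) σ' ∧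
      permDec σ' (d ∘ f) = permDec σ d ∘ f' ∧
      permSetoid σ' (Γ.comap f) = (permSetoid σ Γ).comap f' := by
  suffices ∃ (σ' : Equiv.Perm (Fin m)) (f' : Fin m → Fin n), StrictMono f' ∧
      AllowedPerm ε (d ∘ f) (Γ.comap f) σ' ∧ ∀ x, f (σ'.symm x) = σ.symm (f' x) by
    obtain ⟨σ', f', hf', hσ', h⟩ := this
    refine ⟨σ', f', hf', hσ', ?_, ?_⟩
    · funext x
      simp [permDec_apply, h]
    · ext x y
      simp [permSetoid_rel, Setoid.comap_rel, h]
  induction hσ with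
  | one => exact ⟨1, f, hf, .one, fun _ => rfl⟩
  | @step σ i j _ hmove ih =>
    obtain ⟨σ', f', hf', hσ', h⟩ := ih
    obtain ⟨hij, hε, hne⟩ := hmove
    by_cases hrange : (∃ k, f' k = i) ∧ ∃ l, f' l = j
    · obtain ⟨⟨k, rfl⟩, ⟨l, rfl⟩⟩ := hrange
      refine ⟨Equiv.swap k l * σ', f', hf', .step k l hσ' ⟨?_, ?_, ?_⟩, fun x => ?_⟩
      · have hkl : k < l := hf'.lt_iff_lt.1 (by rw [Fin.lt_def]; omega)
        by_contra hne
        have hlt : (k : ℕ) + 1 < l := by rw [Fin.lt_def] at hkl; omega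
        have h₁ : f' k < f' ⟨k + 1, by omega⟩ := hf' (by simp [Fin.lt_def])
        have h₂ : f' ⟨k + 1, by omega⟩ < f' l := hf' (by simpa [Fin.lt_def] using hlt)
        rw [Fin.lt_def] at h₁ h₂
        omega
      · simpa [permDec_apply, h] using hε
      · simpa [permDec_apply, permSetoid_rel, Setoid.comap_rel, h] using hne
      · simp [Equiv.Perm.mul_def, h, hf'.injective.map_swap]
    · exact ⟨σ', Equiv.swap i j ∘ f', strictMono_swap_comp hf' hij hrange, hσ',
        fun x => by simp [Equiv.Perm.mul_def, h]⟩

/-- A strictly monotone map with values in `T` factors through the standardization of `T`. -/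
theorem exists_strictMono_orderIsoOfFin {m n : ℕ} {f : Fin m → Fin n} (hf : StrictMono f)
    (T : Finset (Fin n)) (hT : ∀ x, f x ∈ T) :
    ∃ g : Fin m → Fin T.card, StrictMono g ∧ ∀ x, (T.orderIsoOfFin rfl (g x)).1 = f x :=
  ⟨fun x => (T.orderIsoOfFin rfl).symm ⟨f x, hT x⟩,
    fun _ _ hxy => (T.orderIsoOfFin rfl).symm.strictMono (hf hxy), fun x => by simp⟩

/-- The pullback of an ε-noncrossing decorated partition along a strictly monotone map is
ε-noncrossing. -/
theorem IsEpsNC.comap {ε : I → I → Bool} {n : ℕ} {d : Fin n → I} {Γ : Setoid (Fin n)}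
    (h : IsEpsNC ε d Γ) {m : ℕ} {f : Fin m → Fin n} (hf : StrictMono f) :
    IsEpsNC ε (d ∘ f) (Γ.comap f) := by
  induction h generalizing m with
  | empty d Γ =>
    obtain rfl : m = 0 := Nat.eq_zero_of_not_pos fun hm => (f ⟨0, hm⟩).elim0
    exact .empty _ _
  | @reduce n d Γ σ b hσ hint _ ih =>
    obtain ⟨σ', f', hf', hσ', hd, hΓ⟩ := hσ.exists_comp_eq hf
    have key : ∀ {k : ℕ} {e : Fin k → Fin m}, StrictMono e →
        (∀ x, f' (e x) ∈ (blockOf (permSetoid σ Γ) b)ᶜ) →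
        IsEpsNC ε (permDec σ d ∘ f' ∘ e) ((permSetoid σ Γ).comap (f' ∘ e)) := by
      intro k e he hmem
      obtain ⟨g, hg, hgf⟩ := exists_strictMono_orderIsoOfFin (hf'.comp he) _ hmem
      convert ih hg using 1
      · funext x
        simp [restrictFun, hgf]
      · ext x y
        simp [restrictSetoid_rel, Setoid.comap_rel, hgf]
    by_cases hb : ∃ b', f' b' ∈ blockOf (permSetoid σ Γ) b
    · obtain ⟨b', hb'⟩ := hb
      have hblock : ∀ x, x ∈ blockOf ((permSetoid σ Γ).comap f') b' ↔
          f' x ∈ blockOf (permSetoid σ Γ) b := by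
        intro x
        simp only [blockOf, Finset.mem_filter, Finset.mem_univ, true_and,
          Setoid.comap_rel] at hb' ⊢
        exact ⟨fun h => Setoid.trans' _ hb' h,
          fun h => Setoid.trans' _ (Setoid.symm' _ hb') h⟩
      refine .reduce σ' b' hσ' ?_ ?_
      · rw [hΓ]
        intro x y z hx hz hxy hyz
        rw [hblock] at hx hz ⊢
        exact hint hx hz (hf'.monotone hxy) (hf'.monotone hyz)
      · rw [hd, hΓ]
        refine key (e := fun k => (Finset.orderIsoOfFin _ rfl k).1)
          (fun x y hxy => (Finset.orderIsoOfFin _ rfl).strictMono hxy) fun x => ?_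
        rw [Finset.mem_compl, ← hblock, ← Finset.mem_compl]
        exact (Finset.orderIsoOfFin _ rfl x).2
    · refine .of_perm hσ' ?_
      rw [hd, hΓ]
      exact key strictMono_id fun x => Finset.mem_compl.2 fun hx => hb ⟨x, hx⟩

/-- If `Γ` is a `d`-decorated ε-noncrossing partition of `[n]` and
`i ∈ [n]`, then the standardization of the restriction of `Γ` to `[n] \ {i}`, with the
standardized restricted decoration, is again ε-noncrossing (a partition of `[n-1]`). -/
theorem isEpsNC_restrict_erase {I : Type*} (ε : I → I → Bool)
    (hsym : ∀ i j : I, ε i j = ε j i)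
    {n : ℕ} (d : Fin n → I) (Γ : Setoid (Fin n)) (hΓ : IsEpsNC ε d Γ) (i : Fin n) :
    IsEpsNC ε (restrictFun d ({i} : Finset (Fin n))ᶜ)
      (restrictSetoid Γ ({i} : Finset (Fin n))ᶜ) := by
  exact hΓ.comap fun x y hxy => (Finset.orderIsoOfFin _ rfl).strictMono hxy

end EpsNC
end

section
/- Fix a decoration d of [n]. If Γ and Γ' are d-decorated ε-noncrossing partitions of [n], then their meet Γ ∧ Γ' in the lattice of partitions of [n] (the partition whose blocks are the nonempty intersections Γ_i ∩ Γ'_j) is again ε-noncrossing. Consequently P^{d,ε}_n, partially ordered by refinement, is a lattice whose meet operation is the restriction of the meet of the full partition lattice. -/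
/-!
Common setup: ε-noncrossing partitions (Ebrahimi-Fard–Patras–Speicher).

A partition of `[n]` is encoded as a `Setoid (Fin n)` (blocks = equivalence
classes).  A decoration is a map `d : Fin n → I`, and `ε : I → I → Bool` is a
symmetric family of values in `{0,1}` (with `true` playing the role of `1`).
-/

namespace EpsNC

open scoped Classical

variable {I : Type*}

/-- Two positions of a decorated partition depend on each other if they may not be swapped
when they become adjacent. -/
def Dependent {α : Type*} (ε : I → I → Bool) (d : α → I) (Γ : Setoid α) (x y : α) : Prop :=
  ε (d x) (d y) = false ∨ (d x = d y ∧ Γ x y)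

/-- The order constraints of a decorated partition: dependent pairs in their original order. -/
def Precedes {n : ℕ} (ε : I → I → Bool) (d : Fin n → I) (Γ : Setoid (Fin n))
    (x y : Fin n) : Prop :=
  x < y ∧ Dependent ε d Γ x y

/-- The blocks of `Γ` restricted to `S` can be removed one after the other, where a block may be
removed once the remaining points admit a labelling by `before`, `inside`, `after`
(that is `0`, `1`, `2`) which is monotone along `E` and takes the value `1` exactly on the block. -/
inductive Eliminable {α : Type*} (E : α → α → Prop) (Γ : Setoid α) : Set α → Prop
  | empty : Eliminable E Γ ∅
  | step {S : Set α} (b : α) (hb : b ∈ S) (r : α → Fin 3)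
      (hmono : ∀ x ∈ S, ∀ y ∈ S, E x y → r x ≤ r y)
      (hmid : ∀ x ∈ S, r x = 1 ↔ Γ b x)
      (hrec : Eliminable E Γ (S \ {x | Γ b x})) : Eliminable E Γ S

namespace Eliminable

variable {α β : Type*} {E E' F : α → α → Prop} {Γ Γ' : Setoid α} {S T : Set α}

theorem subset (h : Eliminable E Γ S) (hT : T ⊆ S) : Eliminable E Γ T := by
  induction h generalizing T with
  | empty => rw [Set.subset_empty_iff.1 hT]; exact .empty
  | @step S b hb r hmono hmid _ ih =>
    by_cases hc : ∃ c ∈ T, Γ b c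
    · obtain ⟨c, hcT, hbc⟩ := hc
      have hblock : ∀ x, Γ c x ↔ Γ b x := fun x =>
        ⟨fun h => Γ.trans' hbc h, fun h => Γ.trans' (Γ.symm' hbc) h⟩
      refine .step c hcT r (fun x hx y hy => hmono x (hT hx) y (hT hy))
        (fun x hx => (hmid x (hT hx)).trans (hblock x).symm) (ih ?_)
      rintro x ⟨hx, hcx⟩
      exact ⟨hT hx, fun h => hcx ((hblock x).2 h)⟩
    · push Not at hc
      exact ih fun x hx => ⟨hT hx, hc x hx⟩

theorem image {D : β → β → Prop} {Δ : Setoid β} {U : Set β} (h : Eliminable D Δ U) (g : β → α)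
    (hg : Function.Injective g) (hΓ : ∀ k l, Γ (g k) (g l) ↔ Δ k l)
    (hE : ∀ k l, E (g k) (g l) → D k l) : Eliminable E Γ (g '' U) := by
  induction h with
  | empty => rw [Set.image_empty]; exact .empty
  | @step U b hb r hmono hmid _ ih =>
    refine .step (g b) (Set.mem_image_of_mem g hb) (Function.extend g r 0) ?_ ?_ ?_
    · rintro _ ⟨k, hk, rfl⟩ _ ⟨l, hl, rfl⟩ hkl
      rw [hg.extend_apply, hg.extend_apply]
      exact hmono k hk l hl (hE k l hkl)
    · rintro _ ⟨k, hk, rfl⟩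
      rw [hg.extend_apply, hmid k hk, hΓ]
    · have : g '' U \ {x | Γ (g b) x} = g '' (U \ {x | Δ b x}) := by
        ext x
        constructor
        · rintro ⟨⟨k, hk, rfl⟩, hx⟩
          exact ⟨k, ⟨hk, fun h => hx ((hΓ b k).2 h)⟩, rfl⟩
        · rintro ⟨k, ⟨hk, hx⟩, rfl⟩
          exact ⟨⟨k, hk, rfl⟩, fun h => hx ((hΓ b k).1 h)⟩
      rw [this]
      exact ih

/-- If a block of `Γ` can be removed, then the blocks of `Γ'` restricted to it can be removed
one by one as blocks of `Γ ⊓ Γ'`. -/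
theorem inf_union (hFE : ∀ x y, F x y → E x y) (hFE' : ∀ x y, F x y → E' x y)
    {b : α} {r : α → Fin 3}
    (hmono : ∀ x ∈ S, ∀ y ∈ S, E x y → r x ≤ r y) (hmid : ∀ x ∈ S, r x = 1 ↔ Γ b x)
    (hrest : Eliminable F (Γ ⊓ Γ') (S \ {x | Γ b x}))
    (hT : Eliminable E' Γ' T) (hTS : T ⊆ S) (hTb : ∀ x ∈ T, Γ b x) :
    Eliminable F (Γ ⊓ Γ') ((S \ {x | Γ b x}) ∪ T) := by
  induction hT with
  | empty => rwa [Set.union_empty]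
  | @step T c hc r' hmono' hmid' _ ih =>
    have hcb := hTb c hc
    have hblock : ∀ x, (Γ ⊓ Γ') c x ↔ Γ b x ∧ Γ' c x := fun x =>
      ⟨fun h => ⟨Γ.trans' hcb h.1, h.2⟩, fun h => ⟨Γ.trans' (Γ.symm' hcb) h.1, h.2⟩⟩
    refine .step c (Or.inr hc) (fun x => if Γ b x then r' x else r x) ?_ ?_ ?_
    · rintro x (⟨hx, hxb⟩ | hx) y (⟨hy, hyb⟩ | hy) hxy
      · rw [Set.mem_ofPred_eq] at hxb hyb
        simp only [hxb, hyb, if_false]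
        exact hmono x hx y hy (hFE x y hxy)
      · rw [Set.mem_ofPred_eq] at hxb
        have h1 := hmono x hx y (hTS hy) (hFE x y hxy)
        have h2 := mt (hmid x hx).1 hxb
        rw [(hmid y (hTS hy)).2 (hTb y hy)] at h1
        simp only [hxb, hTb y hy, if_false, if_true]
        omega
      · rw [Set.mem_ofPred_eq] at hyb
        have h1 := hmono x (hTS hx) y hy (hFE x y hxy)
        have h2 := mt (hmid y hy).1 hyb
        rw [(hmid x (hTS hx)).2 (hTb x hx)] at h1
        simp only [hyb, hTb x hx, if_false, if_true]
        omega
      · simp only [hTb x hx, hTb y hy, if_true]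
        exact hmono' x hx y hy (hFE' x y hxy)
    · rintro x (⟨hx, hxb⟩ | hx)
      · rw [Set.mem_ofPred_eq] at hxb
        simp only [hxb, if_false, hblock, false_and, hmid x hx]
      · simp only [hTb x hx, if_true, hblock, true_and, hmid' x hx]
    · have hdiff : ((S \ {x | Γ b x}) ∪ T) \ {x | (Γ ⊓ Γ') c x} =
          (S \ {x | Γ b x}) ∪ (T \ {x | Γ' c x}) := by
        ext x
        have := hTb x
        simp only [Set.mem_sdiff, Set.mem_union, Set.mem_ofPred_eq, hblock]
        tauto
      rw [hdiff]
      exact ih (fun x hx => hTS hx.1) (fun x hx => hTb x hx.1)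

theorem inf (h : Eliminable E Γ S) (h' : Eliminable E' Γ' S)
    (hFE : ∀ x y, F x y → E x y) (hFE' : ∀ x y, F x y → E' x y) :
    Eliminable F (Γ ⊓ Γ') S := by
  induction h with
  | empty => exact .empty
  | @step S b hb r hmono hmid _ ih =>
    have key := inf_union hFE hFE' hmono hmid (ih (h'.subset Set.sdiff_subset))
      (h'.subset (Set.inter_subset_left (t := {x | Γ b x})))
      Set.inter_subset_left (fun x hx => hx.2)
    rwa [Set.sdiff_union_inter] at key

end Eliminable

section Permutations

variable {n : ℕ} {ε : I → I → Bool} {d : Fin n → I} {Γ : Setoid (Fin n)}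
  {σ : Equiv.Perm (Fin n)}

theorem permSetoid_apply {x y : Fin n} :
    permSetoid σ Γ x y ↔ Γ (σ⁻¹ x) (σ⁻¹ y) := Iff.rfl

theorem AllowedPerm.lt_of_precedes (hσ : AllowedPerm ε d Γ σ) {x y : Fin n}
    (h : Precedes ε d Γ x y) : σ x < σ y := by
  induction hσ with
  | one => exact h.1
  | @step σ i j _ hmove ih =>
    obtain ⟨hij, hε, hne⟩ := hmove
    have hnot : ¬ (σ x = i ∧ σ y = j) := by
      rintro ⟨rfl, rfl⟩
      have hdx : permDec σ d (σ x) = d x := by simp [permDec]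
      have hdy : permDec σ d (σ y) = d y := by simp [permDec]
      have hΓ : permSetoid σ Γ (σ x) (σ y) ↔ Γ x y := by
        simp [permSetoid_apply]
      rw [hdx, hdy] at hε hne
      rw [hΓ] at hne
      rcases h.2 with h | h
      · rw [hε] at h; cases h
      · exact hne.elim (fun hd => hd h.1) (fun hb => hb h.2)
    simp only [Equiv.Perm.mul_apply, Equiv.swap_apply_def]
    split_ifs <;> omega

theorem allowedPerm_of_lt_of_precedes
    (h : ∀ x y, Precedes ε d Γ x y → σ x < σ y) : AllowedPerm ε d Γ σ := by
  suffices H : ∀ f : Lex (Fin n → Fin n), ∀ τ : Equiv.Perm (Fin n), toLex (⇑τ⁻¹) = f →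
      (∀ x y, Precedes ε d Γ x y → τ x < τ y) → AllowedPerm ε d Γ τ from H _ σ rfl h
  intro f
  induction f using WellFoundedLT.induction with
  | _ f ih =>
  rintro τ rfl hτ
  by_cases hdesc : ∃ i j : Fin n, (i : ℕ) + 1 = j ∧ τ⁻¹ j < τ⁻¹ i
  · obtain ⟨i, j, hij, hlt⟩ := hdesc
    set x := τ⁻¹ j with hx
    set y := τ⁻¹ i with hy
    have hτx : τ x = j := by simp [hx]
    have hτy : τ y = i := by simp [hy]
    have hinv : ⇑(Equiv.swap i j * τ)⁻¹ = ⇑τ⁻¹ ∘ ⇑(Equiv.swap i j) := by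
      ext k; simp
    have hxy : ¬ Precedes ε d Γ x y := fun hp => by
      have := hτ x y hp
      omega
    have hdep : ¬ Dependent ε d Γ x y := fun hd => hxy ⟨hlt, hd⟩
    have hallowed : AllowedPerm ε d Γ (Equiv.swap i j * τ) := by
      refine ih _ ?_ _ rfl ?_
      · rw [hinv]
        exact Pi.lex_desc (by omega) hlt
      · intro u v huv
        have huv' := hτ u v huv
        have hnot : ¬ (τ u = i ∧ τ v = j) := by
          rintro ⟨hu, hv⟩
          have hu' : u = y := by rw [hy, ← hu]; simp
          have hv' : v = x := by rw [hx, ← hv]; simp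
          have := huv.1
          omega
        simp only [Equiv.Perm.mul_apply, Equiv.swap_apply_def]
        split_ifs <;> omega
    have hτeq : τ = Equiv.swap i j * (Equiv.swap i j * τ) := by
      rw [← mul_assoc, Equiv.swap_mul_self, one_mul]
    rw [hτeq]
    refine .step i j hallowed ⟨hij, ?_⟩
    have hi : (Equiv.swap i j * τ)⁻¹ i = x := by rw [hinv]; simp [hx]
    have hj : (Equiv.swap i j * τ)⁻¹ j = y := by rw [hinv]; simp [hy]
    simp only [permDec, permSetoid_apply, Function.comp_apply, hi, hj]
    simp only [Dependent, not_or, not_and, Bool.not_eq_false] at hdep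
    exact ⟨hdep.1, or_iff_not_imp_left.2 fun hd => hdep.2 (not_not.1 hd)⟩
  · push Not at hdesc
    have hmono : Monotone ⇑τ⁻¹ := by
      cases n with
      | zero => exact Subsingleton.monotone _
      | succ n => exact Fin.monotone_iff_le_succ.2 fun i => hdesc _ _ (by simp)
    rw [inv_eq_one.1 ((Equiv.Perm.monotone_iff τ⁻¹).1 hmono)]
    exact .one

theorem mem_blockOf {b x : Fin n} : x ∈ blockOf Γ b ↔ Γ b x := by simp [blockOf]

/-- The positions left after a reduction, seen in the partition before the reduction. -/
noncomputable def survivor (σ : Equiv.Perm (Fin n)) (S : Finset (Fin n)) (k : Fin S.card) :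
    Fin n :=
  σ⁻¹ (S.orderIsoOfFin rfl k).1

theorem apply_survivor (S : Finset (Fin n)) (k : Fin S.card) :
    σ (survivor σ S k) = (S.orderIsoOfFin rfl k).1 :=
  σ.apply_symm_apply _

theorem survivor_injective (S : Finset (Fin n)) : Function.Injective (survivor σ S) :=
  (σ⁻¹).injective.comp (Subtype.val_injective.comp (S.orderIsoOfFin rfl).injective)

theorem range_survivor (S : Finset (Fin n)) : Set.range (survivor σ S) = {x | σ x ∈ S} := by
  ext x
  constructor
  · rintro ⟨k, rfl⟩
    rw [Set.mem_ofPred_eq, apply_survivor]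
    exact (S.orderIsoOfFin rfl k).2
  · intro hx
    exact ⟨(S.orderIsoOfFin rfl).symm ⟨σ x, hx⟩, by simp [survivor]⟩

theorem lt_iff_survivor (S : Finset (Fin n)) {k l : Fin S.card} :
    k < l ↔ σ (survivor σ S k) < σ (survivor σ S l) := by
  rw [apply_survivor, apply_survivor]
  exact (S.orderIsoOfFin rfl).lt_iff_lt.symm

theorem precedes_restrict_iff (S : Finset (Fin n)) {k l : Fin S.card} :
    Precedes ε (restrictFun (permDec σ d) S) (restrictSetoid (permSetoid σ Γ) S) k l ↔
      σ (survivor σ S k) < σ (survivor σ S l) ∧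
        Dependent ε d Γ (survivor σ S k) (survivor σ S l) :=
  and_congr (lt_iff_survivor S) Iff.rfl

end Permutations

theorem IsEpsNC.eliminable {ε : I → I → Bool} {n : ℕ} {d : Fin n → I} {Γ : Setoid (Fin n)}
    (h : IsEpsNC ε d Γ) : Eliminable (Precedes ε d Γ) Γ Set.univ := by
  induction h with
  | empty d Γ => rw [Set.univ_eq_empty_iff.2 inferInstance]; exact .empty
  | @reduce n d Γ σ b hσ hint _ ih =>
    have hblock : ∀ x, σ x ∈ blockOf (permSetoid σ Γ) b ↔ Γ (σ⁻¹ b) x := fun x => by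
      simp [mem_blockOf, permSetoid_apply]
    have hb : b ∈ blockOf (permSetoid σ Γ) b := mem_blockOf.2 ((permSetoid σ Γ).refl' b)
    refine .step (σ⁻¹ b) (Set.mem_univ _)
      (fun x => if Γ (σ⁻¹ b) x then 1 else if σ x < b then 0 else 2) ?_ ?_ ?_
    · intro x _ y _ hxy
      have hlt := hσ.lt_of_precedes hxy
      have hx := hblock x
      have hy := hblock y
      have h1 : Γ (σ⁻¹ b) x → ¬ Γ (σ⁻¹ b) y → b ≤ σ y := fun hx' hy' => by
        by_contra! hc
        exact hy' (hy.1 (hint (hx.2 hx') hb hlt.le hc.le))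
      have h2 : Γ (σ⁻¹ b) y → ¬ Γ (σ⁻¹ b) x → σ x < b := fun hy' hx' => by
        by_contra! hc
        exact hx' (hx.1 (hint hb (hy.2 hy') hc hlt.le))
      split_ifs with ha hc he hf hg <;> first | decide | (exfalso; grind)
    · intro x _
      split_ifs <;> simp_all
    · have := ih.image (E := Precedes ε d Γ) (Γ := Γ)
        (survivor σ (blockOf (permSetoid σ Γ) b)ᶜ) (survivor_injective _)
        (fun k l => Iff.rfl)
        (fun k l hkl => (precedes_restrict_iff _).2 ⟨hσ.lt_of_precedes hkl, hkl.2⟩)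
      rw [Set.image_univ, range_survivor] at this
      convert this using 1
      ext x
      simp [hblock]

theorem Eliminable.isEpsNC {α : Type*} {ε : I → I → Bool} (hsym : ∀ i j, ε i j = ε j i)
    {E : α → α → Prop} {Γ : Setoid α} {S : Set α} (h : Eliminable E Γ S)
    {n : ℕ} {d : Fin n → I} {Δ : Setoid (Fin n)} (g : Fin n → α) (hg : Set.range g = S)
    (hΔ : ∀ k l, Δ k l ↔ Γ (g k) (g l))
    (hE : ∀ k l, Precedes ε d Δ k l → E (g k) (g l)) : IsEpsNC ε d Δ := by
  induction h generalizing n with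
  | empty =>
    have : IsEmpty (Fin n) := Set.range_eq_empty_iff.1 hg
    obtain rfl : n = 0 := by
      by_contra hn
      exact this.false ⟨0, Nat.pos_of_ne_zero hn⟩
    exact .empty d Δ
  | @step S b hb r hmono hmid _ ih =>
    have hgS : ∀ k, g k ∈ S := fun k => hg ▸ Set.mem_range_self k
    obtain ⟨c, rfl⟩ : ∃ c, g c = b := by rwa [← hg] at hb
    set σ := (Tuple.sort (r ∘ g))⁻¹ with hσ
    obtain ⟨hsort, hstable⟩ := Tuple.eq_sort_iff.1 (show σ⁻¹ = Tuple.sort (r ∘ g) by simp [hσ])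
    have hrank : ∀ x y, σ x ≤ σ y → r (g x) ≤ r (g y) := fun x y hxy => by
      simpa using hsort hxy
    have hlt : ∀ x y, Precedes ε d Δ x y → σ x < σ y := by
      intro x y hxy
      by_contra! hc
      have h1 := hmono _ (hgS x) _ (hgS y) (hE x y hxy)
      have hne : σ y ≠ σ x := fun h => hxy.1.ne' (σ.injective h)
      have := hstable _ _ (lt_of_le_of_ne hc hne)
        (by simpa using le_antisymm (hrank _ _ hc) h1)
      exact lt_asymm (by simpa using this) hxy.1
    have hblock : ∀ x, σ x ∈ blockOf (permSetoid σ Δ) (σ c) ↔ r (g x) = 1 := fun x => by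
      simp [mem_blockOf, permSetoid_apply, hΔ, hmid _ (hgS x)]
    refine .reduce σ (σ c) (allowedPerm_of_lt_of_precedes hlt) ?_
      (ih (g ∘ survivor σ _) ?_ (fun k l => hΔ _ _) fun k l hkl => ?_)
    · intro x y z hx hz hxy hyz
      obtain ⟨x, rfl⟩ := σ.surjective x
      obtain ⟨y, rfl⟩ := σ.surjective y
      obtain ⟨z, rfl⟩ := σ.surjective z
      rw [hblock] at hx hz ⊢
      exact le_antisymm (hz ▸ hrank _ _ hyz) (hx ▸ hrank _ _ hxy)
    · rw [Set.range_comp, range_survivor]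
      ext a
      simp only [Set.mem_image, Set.mem_ofPred_eq, Finset.mem_compl, hblock, Set.mem_sdiff]
      constructor
      · rintro ⟨x, hx, rfl⟩
        exact ⟨hgS x, fun h => hx ((hmid _ (hgS x)).2 h)⟩
      · rintro ⟨ha, hca⟩
        obtain ⟨x, rfl⟩ : ∃ x, g x = a := by rwa [← hg] at ha
        exact ⟨x, fun h => hca ((hmid _ ha).1 h), rfl⟩
    · obtain ⟨hkl, hdep⟩ := (precedes_restrict_iff _).1 hkl
      refine hE _ _ ⟨?_, hdep⟩
      by_contra! hc
      have hne : survivor σ _ l ≠ survivor σ _ k := fun h => hkl.ne' (congrArg σ h)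
      refine lt_asymm hkl (hlt _ _ ⟨lt_of_le_of_ne hc hne, ?_⟩)
      exact hdep.imp (fun h => hsym _ _ ▸ h) (fun h => ⟨h.1.symm, Δ.symm' h.2⟩)

theorem isEpsNC_iff_eliminable {ε : I → I → Bool} (hsym : ∀ i j, ε i j = ε j i)
    {n : ℕ} {d : Fin n → I} {Γ : Setoid (Fin n)} :
    IsEpsNC ε d Γ ↔ Eliminable (Precedes ε d Γ) Γ Set.univ :=
  ⟨IsEpsNC.eliminable, fun h =>
    h.isEpsNC hsym id Set.range_id (fun _ _ => Iff.rfl) (fun _ _ => id)⟩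

theorem Precedes.mono {ε : I → I → Bool} {n : ℕ} {d : Fin n → I} {Γ Δ : Setoid (Fin n)}
    (hle : Γ ≤ Δ) {x y : Fin n} (h : Precedes ε d Γ x y) : Precedes ε d Δ x y :=
  ⟨h.1, h.2.imp_right fun hd => ⟨hd.1, hle hd.2⟩⟩

theorem IsEpsNC.inf {ε : I → I → Bool} (hsym : ∀ i j, ε i j = ε j i)
    {n : ℕ} {d : Fin n → I} {Γ Γ' : Setoid (Fin n)} (h : IsEpsNC ε d Γ) (h' : IsEpsNC ε d Γ') :
    IsEpsNC ε d (Γ ⊓ Γ') :=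
  (isEpsNC_iff_eliminable hsym).2 <| h.eliminable.inf h'.eliminable
    (fun _ _ => Precedes.mono inf_le_left) (fun _ _ => Precedes.mono inf_le_right)

theorem isEpsNC_top {ε : I → I → Bool} (hsym : ∀ i j, ε i j = ε j i) {n : ℕ} (d : Fin n → I) :
    IsEpsNC ε d ⊤ := by
  rw [isEpsNC_iff_eliminable hsym]
  rcases isEmpty_or_nonempty (Fin n) with hn | ⟨⟨b⟩⟩
  · rw [Set.univ_eq_empty_iff.2 hn]; exact .empty
  · refine .step b (Set.mem_univ b) 1 (fun _ _ _ _ _ => le_rfl)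
      (fun x _ => iff_of_true rfl trivial) ?_
    have : (Set.univ : Set (Fin n)) \ {x | (⊤ : Setoid (Fin n)) b x} = ∅ :=
      Set.eq_empty_of_forall_notMem fun x hx => hx.2 trivial
    rw [this]
    exact .empty

theorem isEpsNC_sInf {ε : I → I → Bool} (hsym : ∀ i j, ε i j = ε j i) {n : ℕ} {d : Fin n → I}
    {s : Set (Setoid (Fin n))} (hs : ∀ Γ ∈ s, IsEpsNC ε d Γ) : IsEpsNC ε d (sInf s) := by
  induction s, s.toFinite using Set.Finite.induction_on with
  | empty => rw [sInf_empty]; exact isEpsNC_top hsym d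
  | @insert Γ s _ _ ih =>
    rw [sInf_insert]
    exact (hs Γ (Set.mem_insert Γ s)).inf hsym (ih fun Δ hΔ => hs Δ (Set.mem_insert_of_mem Γ hΔ))

/-- The meet (in the full partition lattice, whose blocks are the
nonempty intersections of blocks) of two `d`-decorated ε-noncrossing partitions of
`[n]` is again ε-noncrossing; consequently `P^{d,ε}_n`, partially ordered by
refinement, is a lattice whose meet is the restriction of the meet of the full
partition lattice. -/
theorem epsNC_lattice {I : Type*} (ε : I → I → Bool)
    (hsym : ∀ i j : I, ε i j = ε j i)
    {n : ℕ} (d : Fin n → I) :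
    (∀ Γ Γ' : Setoid (Fin n), IsEpsNC ε d Γ → IsEpsNC ε d Γ' → IsEpsNC ε d (Γ ⊓ Γ')) ∧
    ∃ L : Lattice {Θ : Setoid (Fin n) // IsEpsNC ε d Θ},
      (∀ a b : {Θ : Setoid (Fin n) // IsEpsNC ε d Θ}, L.le a b ↔ a.1 ≤ b.1) ∧
      (∀ a b : {Θ : Setoid (Fin n) // IsEpsNC ε d Θ}, (L.inf a b).1 = a.1 ⊓ b.1) := by
  refine ⟨fun Γ Γ' h h' => h.inf hsym h', ?_⟩
  refine ⟨{ sup := fun a b => ⟨epsJoin ε d a.1 b.1, isEpsNC_sInf hsym fun Θ hΘ => hΘ.1⟩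
            inf := fun a b => ⟨a.1 ⊓ b.1, a.2.inf hsym b.2⟩
            le_sup_left := fun a b => show a.1 ≤ epsJoin ε d a.1 b.1 from
              le_sInf fun Θ hΘ => hΘ.2.1
            le_sup_right := fun a b => show b.1 ≤ epsJoin ε d a.1 b.1 from
              le_sInf fun Θ hΘ => hΘ.2.2
            sup_le := fun a b c hac hbc => show epsJoin ε d a.1 b.1 ≤ c.1 from
              sInf_le ⟨c.2, hac, hbc⟩
            inf_le_left := fun a b => show a.1 ⊓ b.1 ≤ a.1 from inf_le_left
            inf_le_right := fun a b => show a.1 ⊓ b.1 ≤ b.1 from inf_le_right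
            le_inf := fun a b c hab hac => show a.1 ≤ b.1 ⊓ c.1 from le_inf hab hac },
    fun _ _ => Iff.rfl, fun _ _ => rfl⟩

end EpsNC
end
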